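/- Let H be a real Hilbert space and T : H → H a bounded self-adjoint positive linear operator. Suppose v ∈ H is a unit vector with T v = μ v for some μ > 0, and there exists κ with 0 ≤ κ < μ such that ‖T w‖ ≤ κ‖w‖ for every w ∈ H orthogonal to v. If x ∈ H satisfies ⟪v, x⟫ ≠ 0, then the Rayleigh quotients of the iterates converge to the top eigenvalue: ⟪T^p x, T^{p+1} x⟫ / ‖T^p x‖² → μ as p → ∞. -/

import Mathlib

open Filter
open scoped RealInnerProductSpace Topology

section PowerMethod

variable {H : Type*} [NormedAddCommGroup H] [InnerProductSpace ℝ H] {T : H →L[ℝ] H}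
  {v : H} {μ κ : ℝ}

theorem pow_apply_of_apply_eq_smul (hTv : T v = μ • v) (p : ℕ) :
    (T ^ p) v = μ ^ p • v := by
  induction p with
  | zero => simp
  | succ p ih =>
    rw [pow_succ, mul_apply_eq_comp, hTv, map_smul, ih, smul_smul, pow_succ']

/-- The orthogonal complement of an eigenvector of a symmetric operator is invariant, so a norm
bound for the operator on this complement can be iterated. -/
theorem inner_pow_apply_eq_zero_and_norm_pow_apply_le
    (hsa : ∀ x y : H, ⟪T x, y⟫ = ⟪x, T y⟫) (hTv : T v = μ • v) (hκ0 : 0 ≤ κ)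
    (hgap : ∀ w : H, ⟪v, w⟫ = 0 → ‖T w‖ ≤ κ * ‖w‖) {w : H} (hw : ⟪v, w⟫ = 0) (p : ℕ) :
    ⟪v, (T ^ p) w⟫ = 0 ∧ ‖(T ^ p) w‖ ≤ κ ^ p * ‖w‖ := by
  induction p with
  | zero => simpa using hw
  | succ p ih =>
    obtain ⟨horth, hnorm⟩ := ih
    rw [pow_succ', mul_apply_eq_comp]
    refine ⟨by rw [← hsa, hTv, real_inner_smul_left, horth, mul_zero], ?_⟩
    calc ‖T ((T ^ p) w)‖ ≤ κ * ‖(T ^ p) w‖ := hgap _ horth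
      _ ≤ κ * (κ ^ p * ‖w‖) := by gcongr
      _ = κ ^ (p + 1) * ‖w‖ := by ring

/-- The rescaled iterates of the power method converge to the projection of the starting vector
onto the top eigenvector. -/
theorem tendsto_inv_pow_smul_pow_apply
    (hsa : ∀ x y : H, ⟪T x, y⟫ = ⟪x, T y⟫) (hv : ‖v‖ = 1) (hμ : 0 < μ) (hTv : T v = μ • v)
    (hκ0 : 0 ≤ κ) (hκμ : κ < μ) (hgap : ∀ w : H, ⟪v, w⟫ = 0 → ‖T w‖ ≤ κ * ‖w‖) (x : H) :
    Tendsto (fun p : ℕ => (μ ^ p)⁻¹ • (T ^ p) x) atTop (𝓝 (⟪v, x⟫ • v)) := by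
  set w := x - ⟪v, x⟫ • v with hw_def
  have hw : ⟪v, w⟫ = 0 := by
    rw [hw_def, inner_sub_right, real_inner_smul_right, real_inner_self_eq_norm_sq, hv]
    ring
  rw [tendsto_iff_norm_sub_tendsto_zero]
  have hratio : Tendsto (fun p : ℕ => (κ / μ) ^ p * ‖w‖) atTop (𝓝 0) := by
    simpa using (tendsto_pow_atTop_nhds_zero_of_lt_one (div_nonneg hκ0 hμ.le)
      ((div_lt_one hμ).2 hκμ)).mul_const ‖w‖
  refine squeeze_zero (fun _ => norm_nonneg _) (fun p => ?_) hratio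
  have hpow : (μ ^ p)⁻¹ • (T ^ p) x - ⟪v, x⟫ • v = (μ ^ p)⁻¹ • (T ^ p) w := by
    rw [hw_def, map_sub, map_smul, pow_apply_of_apply_eq_smul hTv, smul_sub,
      smul_comm ⟪v, x⟫ (μ ^ p) v, inv_smul_smul₀ (pow_pos hμ p).ne']
  rw [hpow, norm_smul, Real.norm_of_nonneg (by positivity), div_pow, div_eq_inv_mul, mul_assoc]
  gcongr
  exact (inner_pow_apply_eq_zero_and_norm_pow_apply_le hsa hTv hκ0 hgap hw p).2

end PowerMethod

/-- Convergence of the Rayleigh quotients of the power-method iterates to the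
top eigenvalue of a bounded self-adjoint positive operator with a spectral gap. -/
theorem rayleigh_quotients_of_iterates_tendsto
    {H : Type*} [NormedAddCommGroup H] [InnerProductSpace ℝ H] [CompleteSpace H]
    (T : H →L[ℝ] H)
    (hsa : ∀ x y : H, ⟪T x, y⟫ = ⟪x, T y⟫)
    (hpos : ∀ x : H, 0 ≤ ⟪x, T x⟫)
    (v : H) (hv : ‖v‖ = 1) (μ : ℝ) (hμ : 0 < μ) (hTv : T v = μ • v)
    (κ : ℝ) (hκ0 : 0 ≤ κ) (hκμ : κ < μ)
    (hgap : ∀ w : H, ⟪v, w⟫ = 0 → ‖T w‖ ≤ κ * ‖w‖)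
    (x : H) (hx : ⟪v, x⟫ ≠ 0) :
    Tendsto (fun p : ℕ => ⟪(T ^ p) x, (T ^ (p + 1)) x⟫ / ‖(T ^ p) x‖ ^ 2)
      atTop (𝓝 μ) := by
  have hlim := tendsto_inv_pow_smul_pow_apply hsa hv hμ hTv hκ0 hκμ hgap x
  have hv0 : v ≠ 0 := norm_ne_zero_iff.1 (by simp [hv])
  have hquot := (hlim.inner ((T.continuous.tendsto _).comp hlim)).div (hlim.norm.pow 2)
    (pow_ne_zero 2 (norm_ne_zero_iff.2 (smul_ne_zero hx hv0)))
  convert hquot using 1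
  · ext p
    have hp : μ ^ p ≠ 0 := (pow_pos hμ p).ne'
    simp only [Pi.div_apply, Function.comp_apply, map_smul, real_inner_smul_left,
      real_inner_smul_right, norm_smul, mul_pow, Real.norm_eq_abs, sq_abs, pow_succ' T,
      mul_apply_eq_comp]
    rw [← mul_assoc, ← sq, mul_div_mul_left _ _ (pow_ne_zero 2 (inv_ne_zero hp))]
  · congr 1
    simp only [map_smul, hTv, real_inner_smul_left, real_inner_smul_right, norm_smul, mul_pow,
      Real.norm_eq_abs, sq_abs, real_inner_self_eq_norm_sq, hv]
    field_simp
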